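/- arXiv:1807.05503 — 2 statements merged into one kernel-verified Lean document; each statement's English description precedes it below -/
import Mathlib

section
/- Free generation by genus 0 correlators (Lemma 3.2): For n ≥ 3 let s_n ∈ ℚ[[t_1,t_2,…]] be the restriction to t_0 = 0 of ⟨⟨1,…,1⟩⟩_{0,n}, explicitly s_n = Σ_{k≥0} (1/k!) Σ_{b_1,…,b_k ≥ 1, b_1+⋯+b_k = n+k−3} [(n+k−3)!/(b_1!⋯b_k!)] t_{b_1}⋯t_{b_k}. Then each s_n with n ≥ 4 lies in the subring ℚ[1/(1−t_1)][t_2,t_3,…] of ℚ[[t_1]][t_2,t_3,…], and the family {s_n}_{n≥4} freely generates ℚ(t_1)[t_2,t_3,…] over ℚ(t_1): the ℚ(t_1)-algebra homomorphism from the polynomial ring ℚ(t_1)[S_4,S_5,S_6,…] to ℚ(t_1)[t_2,t_3,…] sending S_n to s_n is an isomorphism. -/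
/-!
STATEMENT 16: Free generation by genus 0 correlators (Lemma 3.2):
each s_n (n ≥ 4) lies in the subring ℚ[1/(1−t_1)][t_2,t_3,…] of
ℚ[[t_1]][t_2,t_3,…], and the ℚ(t_1)-algebra homomorphism
ℚ(t_1)[S_4,S_5,…] → ℚ(t_1)[t_2,t_3,…], S_n ↦ s_n, is an isomorphism.

The isomorphism statement is rendered inside the ambient ring
A = ℚ[[t_0,t_1,…]] as: (injectivity) the family consisting of t_1 together
with the s_n (n ≥ 4) is algebraically independent over ℚ — equivalently,
the s_n are algebraically independent over ℚ(t_1); and (surjectivity) each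
t_i (i ≥ 2), after clearing a nonzero polynomial denominator g(t_1) ∈ ℚ[t_1],
lies in the ℚ-subalgebra generated by t_1 and the s_n — equivalently, t_i is a
polynomial in the s_n with coefficients in ℚ(t_1).
-/

noncomputable section

/-- The degree-`k` part of the correlator `⟨⟨1,…,1⟩⟩_{0,n}`. -/
def corrPoly (n : ℕ) (a : Fin n → ℕ) (k : ℕ) : MvPolynomial ℕ ℚ :=
  if 3 ≤ n + k ∧ (∑ i, a i) ≤ n + k - 3 then
    ((k.factorial : ℚ)⁻¹) •
      ∑ b ∈ Finset.Nat.antidiagonalTuple k (n + k - 3 - ∑ i, a i),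
        MvPolynomial.C (((n + k - 3).factorial : ℚ) /
          ((∏ i, ((a i).factorial : ℚ)) * ∏ j, ((b j).factorial : ℚ))) *
          ∏ j, MvPolynomial.X (b j)
  else 0

/-- The correlator `⟨⟨ψ^{a_1},…,ψ^{a_n}⟩⟩_{0,n} ∈ ℚ[[t_0,t_1,…]]`. -/
def corr (n : ℕ) (a : Fin n → ℕ) : MvPowerSeries ℕ ℚ :=
  fun m => MvPolynomial.coeff m (corrPoly n a (m.sum fun _ e => e))

/-- `s_n = ⟨⟨1,…,1⟩⟩_{0,n}|_{t_0=0}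
 = Σ_{k≥0} (1/k!) Σ_{b_j≥1, Σb=n+k−3} [(n+k−3)!/(b_1!⋯b_k!)] t_{b_1}⋯t_{b_k}`. -/
def sCorr (n : ℕ) : MvPowerSeries ℕ ℚ :=
  fun m => if m 0 = 0 then corr n (fun _ => 0) m else 0

namespace Stmt16

open Finset

/-- Weight `Σ i m_i`. -/
def W (m : ℕ →₀ ℕ) : ℕ := m.sum fun i e => i * e

/-- Degree `Σ m_i`. -/
def dg (m : ℕ →₀ ℕ) : ℕ := m.sum fun _ e => e

/-- Denominator `∏ m_i! (i!)^{m_i}`. -/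
def D (m : ℕ →₀ ℕ) : ℚ := m.prod fun i e => (e.factorial : ℚ) * (i.factorial : ℚ) ^ e

lemma W_add (a b : ℕ →₀ ℕ) : W (a + b) = W a + W b := by
  unfold W
  exact Finsupp.sum_add_index' (by simp) (by intros; ring)

lemma dg_add (a b : ℕ →₀ ℕ) : dg (a + b) = dg a + dg b := by
  unfold dg
  exact Finsupp.sum_add_index' (by simp) (by intros; ring)

lemma W_single (i e : ℕ) : W (Finsupp.single i e) = i * e := by
  simp [W]

lemma dg_single (i e : ℕ) : dg (Finsupp.single i e) = e := by
  simp [dg]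

lemma W_ge (m : ℕ →₀ ℕ) (h : ∀ i ∈ m.support, 2 ≤ i) : 2 * dg m ≤ W m := by
  unfold W dg Finsupp.sum
  rw [Finset.mul_sum]
  exact Finset.sum_le_sum fun i hi => Nat.mul_le_mul_right _ (h i hi)

lemma dg_eq_zero (m : ℕ →₀ ℕ) (h : dg m = 0) : m = 0 := by
  unfold dg Finsupp.sum at h
  rw [Finset.sum_eq_zero_iff] at h
  ext i
  by_contra hi
  exact hi (h i (by simpa using hi))

lemma le_dg (m : ℕ →₀ ℕ) (i : ℕ) : m i ≤ dg m := by
  by_cases hi : i ∈ m.support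
  · unfold dg Finsupp.sum
    exact Finset.single_le_sum (f := fun i => m i) (fun _ _ => Nat.zero_le _) hi
  · simp at hi; omega

/-- The condition on exponents `m'` in `t_2, t_3, …`. -/
def cond (n : ℕ) (m : ℕ →₀ ℕ) : Prop :=
  m 0 = 0 ∧ m 1 = 0 ∧ W m + 3 = n + dg m

lemma cond_support {n : ℕ} {m : ℕ →₀ ℕ} (h : cond n m) : ∀ i ∈ m.support, 2 ≤ i := by
  intro i hi
  obtain ⟨h0, h1, -⟩ := h
  simp at hi
  by_contra hlt
  have : i = 0 ∨ i = 1 := by omega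
  rcases this with rfl | rfl <;> contradiction

lemma cond_top {n : ℕ} {m : ℕ →₀ ℕ} (h : cond n m) {i : ℕ} (hi : i ∈ m.support)
    (hn : n - 2 ≤ i) : m = Finsupp.single (n - 2) 1 := by
  have hs := cond_support h
  have hle : Finsupp.single i 1 ≤ m := by
    rw [Finsupp.single_le_iff]
    simp at hi; omega
  obtain ⟨r, rfl⟩ := exists_add_of_le hle
  have hr : ∀ j ∈ r.support, 2 ≤ j := by
    intro j hj
    apply hs
    simp at hj ⊢
    intro _
    exact hj
  have h1 := W_ge r hr
  have h2 := h.2.2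
  have h3 := hs i hi
  rw [W_add, dg_add, W_single, dg_single] at h2
  have hr0 : r = 0 := dg_eq_zero r (by omega)
  have : i = n - 2 := by
    subst hr0
    simp [W, dg] at h2
    omega
  subst hr0
  simp [this]

lemma cond_finite (n : ℕ) : {m | cond n m}.Finite := by
  apply Set.Finite.subset (Set.finite_Iic
    (∑ i ∈ Finset.range (n + 1), Finsupp.single i n))
  intro m hm
  simp only [Set.mem_Iic]
  have hd : dg m ≤ n := by
    have := W_ge m (cond_support hm)
    have := hm.2.2
    omega
  intro i
  by_cases hi : i ∈ m.support
  · have : i < n + 1 := by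
      by_contra hlt
      have := cond_top hm hi (by omega)
      rw [this] at hi
      simp [Finsupp.single_apply] at hi
      omega
    rw [Finsupp.finsetSum_apply]
    simp only [Finsupp.single_apply, Finset.sum_ite_eq', Finset.mem_range, this, if_true]
    exact (le_dg m i).trans hd
  · simp at hi; simp [hi]

/-- The finite set of exponents. -/
def F (n : ℕ) : Finset (ℕ →₀ ℕ) := (cond_finite n).toFinset

lemma mem_F {n : ℕ} {m : ℕ →₀ ℕ} : m ∈ F n ↔ cond n m := by simp [F]

section generic
variable {R : Type*} [CommRing R] [Algebra ℚ R]

/-- one term -/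
def term (n : ℕ) (u : R) (t : ℕ → R) (m : ℕ →₀ ℕ) : R :=
  algebraMap ℚ R (((n + dg m - 3).factorial : ℚ) / D m) * u ^ (n + dg m - 2) *
    m.prod fun i e => t i ^ e

/-- Generic `s_n`. -/
def S (n : ℕ) (u : R) (t : ℕ → R) : R := ∑ m ∈ F n, term n u t m

/-- Nonleading part. -/
def rest (n : ℕ) (u : R) (t : ℕ → R) : R :=
  ∑ m ∈ (F n).erase (Finsupp.single (n - 2) 1), term n u t m

lemma S_eq (n : ℕ) (hn : 4 ≤ n) (u : R) (t : ℕ → R) :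
    S n u t = u ^ (n - 1) * t (n - 2) + rest n u t := by
  have hmem : Finsupp.single (n - 2) 1 ∈ F n := by
    rw [mem_F]
    refine ⟨?_, ?_, ?_⟩
    · rw [Finsupp.single_apply, if_neg (by omega)]
    · rw [Finsupp.single_apply, if_neg (by omega)]
    · rw [W_single, dg_single]; omega
  unfold S rest
  rw [← Finset.add_sum_erase _ _ hmem]
  congr 1
  unfold term
  rw [dg_single]
  have e1 : n + 1 - 3 = n - 2 := by omega
  have e2 : n + 1 - 2 = n - 1 := by omega
  have : ((n - 2).factorial : ℚ) ≠ 0 := by exact_mod_cast Nat.factorial_ne_zero _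
  simp [D, e1, e2, this]

lemma rest_support {n : ℕ} {m : ℕ →₀ ℕ}
    (hm : m ∈ (F n).erase (Finsupp.single (n - 2) 1)) :
    ∀ i ∈ m.support, 2 ≤ i ∧ i < n - 2 := by
  intro i hi
  rw [Finset.mem_erase, mem_F] at hm
  refine ⟨cond_support hm.2 i hi, ?_⟩
  by_contra hlt
  exact hm.1 (cond_top hm.2 hi (by omega))

lemma rest_congr (n : ℕ) (u : R) (t t' : ℕ → R)
    (h : ∀ i, 2 ≤ i → i < n - 2 → t i = t' i) : rest n u t = rest n u t' := by
  unfold rest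
  refine Finset.sum_congr rfl fun m hm => ?_
  unfold term
  congr 1
  refine Finset.prod_congr rfl fun i hi => ?_
  have := rest_support hm i hi
  simp only [h i this.1 this.2]

lemma map_S {R' : Type*} [CommRing R'] [Algebra ℚ R'] (f : R →ₐ[ℚ] R') (n : ℕ) (u : R)
    (t : ℕ → R) : f (S n u t) = S n (f u) (fun i => f (t i)) := by
  simp [S, term, Finsupp.prod, map_sum, map_prod]

lemma term_mem (A : Subalgebra ℚ R) (n : ℕ) (u : R) (t : ℕ → R) (m : ℕ →₀ ℕ) (hu : u ∈ A)
    (ht : ∀ i ∈ m.support, t i ∈ A) : term n u t m ∈ A := by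
  unfold term
  refine A.mul_mem (A.mul_mem (A.algebraMap_mem _) (A.pow_mem hu _)) ?_
  exact A.prod_mem fun i hi => A.pow_mem (ht i hi) _

end generic

/-! ### The coefficient formula -/

/-- The content of a tuple. -/
def content {k : ℕ} (b : Fin k → ℕ) : ℕ →₀ ℕ := ∑ j, Finsupp.single (b j) 1

lemma W_content {k : ℕ} (b : Fin k → ℕ) : W (content b) = ∑ j, b j := by
  have : ∀ s : Finset (Fin k), W (∑ j ∈ s, Finsupp.single (b j) 1) = ∑ j ∈ s, b j := by
    intro s
    induction s using Finset.induction_on with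
    | empty => simp [W]
    | insert a s ha ih => rw [Finset.sum_insert ha, Finset.sum_insert ha, W_add, ih, W_single,
        mul_one]
  exact this _

lemma content_apply_pos {k : ℕ} (b : Fin k → ℕ) (j : Fin k) : content b (b j) ≠ 0 := by
  unfold content
  rw [Finsupp.finsetSum_apply]
  intro h
  rw [Finset.sum_eq_zero_iff] at h
  simpa using h j (Finset.mem_univ _)

lemma prod_monomial {k : ℕ} (b : Fin k → ℕ) (g : ℕ → ℚ) :
    ∏ j, (MvPolynomial.C (g (b j)) * MvPolynomial.X (b j) : MvPolynomial ℕ ℚ) =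
      MvPolynomial.monomial (content b) (∏ j, g (b j)) := by
  rw [Finset.prod_mul_distrib, MvPolynomial.monomial_eq, ← map_prod]
  congr 1
  unfold content
  have : ∀ s : Finset (Fin k), ∏ j ∈ s, (MvPolynomial.X (b j) : MvPolynomial ℕ ℚ) =
      MvPolynomial.monomial (∑ j ∈ s, Finsupp.single (b j) 1) 1 := by
    intro s
    induction s using Finset.induction_on with
    | empty => simp
    | insert a s ha ih =>
      rw [Finset.prod_insert ha, Finset.sum_insert ha, ih, MvPolynomial.X,
        MvPolynomial.monomial_mul, mul_one]
  rw [this, MvPolynomial.monomial_eq, map_one, one_mul]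

/-- The multinomial count. -/
lemma count (m : ℕ →₀ ℕ) (L : ℕ) (hL : ∀ i ∈ m.support, i < L) :
    ∑ b ∈ Fintype.piFinset (fun _ : Fin (dg m) => Finset.range L),
      (if content b = m then ∏ j, ((b j).factorial : ℚ)⁻¹ else 0) =
      ((dg m).factorial : ℚ) / D m := by
  classical
  have hsub : m.support ⊆ Finset.range L := fun i hi => Finset.mem_range.2 (hL i hi)
  have hdg : ∑ i ∈ Finset.range L, m i = dg m := by
    unfold dg
    rw [Finsupp.sum_of_support_subset m hsub _ (by simp)]
  have hD : D m = ∏ i ∈ Finset.range L, (((m i).factorial : ℚ) * (i.factorial : ℚ) ^ (m i)) := by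
    unfold D
    rw [Finsupp.prod_of_support_subset m hsub _ (by simp)]
  have e1 : (∑ i ∈ Finset.range L,
      (MvPolynomial.C ((i.factorial : ℚ)⁻¹) * MvPolynomial.X i : MvPolynomial ℕ ℚ)) ^ (dg m) =
      ∑ b ∈ Fintype.piFinset (fun _ : Fin (dg m) => Finset.range L),
        MvPolynomial.monomial (content b) (∏ j, ((b j).factorial : ℚ)⁻¹) := by
    rw [← Fin.prod_const, Finset.prod_univ_sum]
    exact Finset.sum_congr rfl fun b _ => prod_monomial b (fun i => (i.factorial : ℚ)⁻¹)
  have e2 := Finset.sum_pow_eq_sum_piAntidiag (Finset.range L)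
    (fun i => (MvPolynomial.C ((i.factorial : ℚ)⁻¹) * MvPolynomial.X i : MvPolynomial ℕ ℚ)) (dg m)
  rw [e1] at e2
  have e3 := congrArg (MvPolynomial.coeff m) e2
  rw [MvPolynomial.coeff_sum, MvPolynomial.coeff_sum] at e3
  simp only [MvPolynomial.coeff_monomial] at e3
  rw [e3]
  have key : ∀ p ∈ (Finset.range L).piAntidiag (dg m),
      MvPolynomial.coeff m ((Nat.multinomial (Finset.range L) p : MvPolynomial ℕ ℚ) *
        ∏ i ∈ Finset.range L, (MvPolynomial.C ((i.factorial : ℚ)⁻¹) * MvPolynomial.X i) ^ p i) =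
      if p = m then (Nat.multinomial (Finset.range L) p : ℚ) *
        ∏ i ∈ Finset.range L, ((i.factorial : ℚ)⁻¹) ^ p i else 0 := by
    intro p hp
    rw [Finset.mem_piAntidiag] at hp
    let q : ℕ →₀ ℕ := Finsupp.onFinset (Finset.range L) p hp.2
    have hq : ∀ i, q i = p i := fun i => rfl
    have hqs : q.support ⊆ Finset.range L := Finsupp.support_onFinset_subset
    have : ((Nat.multinomial (Finset.range L) p : MvPolynomial ℕ ℚ) *
        ∏ i ∈ Finset.range L, (MvPolynomial.C ((i.factorial : ℚ)⁻¹) * MvPolynomial.X i) ^ p i) =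
        MvPolynomial.monomial q ((Nat.multinomial (Finset.range L) p : ℚ) *
        ∏ i ∈ Finset.range L, ((i.factorial : ℚ)⁻¹) ^ p i) := by
      rw [MvPolynomial.monomial_eq, Finsupp.prod_of_support_subset q hqs _ (by simp)]
      simp only [mul_pow, Finset.prod_mul_distrib, hq, map_mul, map_prod, map_pow, map_natCast]
      ring
    rw [this, MvPolynomial.coeff_monomial]
    have : q = m ↔ p = m := by
      rw [← DFunLike.coe_fn_eq]; rfl
    simp only [this]
  rw [Finset.sum_congr rfl key, Finset.sum_ite_eq' , if_pos]
  · have hs := Nat.multinomial_spec (Finset.range L) m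
    rw [hdg] at hs
    rw [← hs, hD, Finset.prod_mul_distrib]
    have h1 : ∏ i ∈ Finset.range L, ((m i).factorial : ℚ) ≠ 0 :=
      Finset.prod_ne_zero_iff.2 fun i _ => by exact_mod_cast Nat.factorial_ne_zero _
    have h2 : ∏ i ∈ Finset.range L, (i.factorial : ℚ) ^ (m i) ≠ 0 :=
      Finset.prod_ne_zero_iff.2 fun i _ =>
        pow_ne_zero _ (by exact_mod_cast Nat.factorial_ne_zero _)
    simp only [inv_pow, Finset.prod_inv_distrib]
    push_cast
    field_simp
  · rw [Finset.mem_piAntidiag]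
    exact ⟨hdg, fun i hi => hsub (by simpa using hi)⟩

lemma coeff_sCorr (n : ℕ) (hn : 4 ≤ n) (m : ℕ →₀ ℕ) :
    sCorr n m = if m 0 = 0 ∧ W m + 3 = n + dg m then
      ((n + dg m - 3).factorial : ℚ) / D m else 0 := by
  unfold sCorr
  by_cases h0 : m 0 = 0
  swap
  · simp [h0]
  simp only [h0, if_true, true_and]
  change MvPolynomial.coeff m (corrPoly n (fun _ => 0) (dg m)) = _
  unfold corrPoly
  rw [if_pos ⟨by omega, by simp⟩, MvPolynomial.coeff_smul, MvPolynomial.coeff_sum]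
  simp only [Finset.sum_const_zero, Nat.factorial_zero, Nat.cast_one, Finset.prod_const_one,
    one_mul, Nat.sub_zero, smul_eq_mul]
  have hterm : ∀ b : Fin (dg m) → ℕ, MvPolynomial.coeff m
      (MvPolynomial.C (((n + dg m - 3).factorial : ℚ) / ∏ j, ((b j).factorial : ℚ)) *
        ∏ j, MvPolynomial.X (b j)) = ((n + dg m - 3).factorial : ℚ) *
        (if content b = m then ∏ j, ((b j).factorial : ℚ)⁻¹ else 0) := by
    intro b
    have := prod_monomial b (fun _ => 1)
    simp only [map_one, one_mul, Finset.prod_const_one] at this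
    rw [this, MvPolynomial.coeff_C_mul, MvPolynomial.coeff_monomial]
    split_ifs <;> simp [div_eq_mul_inv]
  change _ * ∑ b ∈ Finset.Nat.antidiagonalTuple (dg m) (n + dg m - 3), _ = _
  rw [Finset.sum_congr rfl fun b _ => hterm b, ← Finset.mul_sum]
  by_cases hW : W m + 3 = n + dg m
  · rw [if_pos hW]
    have hsum : ∑ b ∈ Finset.Nat.antidiagonalTuple (dg m) (n + dg m - 3),
        (if content b = m then ∏ j, ((b j).factorial : ℚ)⁻¹ else 0) =
        ((dg m).factorial : ℚ) / D m := by
      have hL : ∀ i ∈ m.support, i < n + dg m := by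
        intro i hi
        have : i * m i ≤ W m :=
          Finset.single_le_sum (f := fun i => i * m i) (fun _ _ => Nat.zero_le _) hi
        have h1 : 1 ≤ m i := by simp at hi; omega
        have : i * 1 ≤ i * m i := Nat.mul_le_mul_left _ h1
        omega
      rw [← count m (n + dg m) hL]
      apply Finset.sum_subset
      · intro b hb
        rw [Finset.Nat.mem_antidiagonalTuple] at hb
        rw [Fintype.mem_piFinset]
        intro j
        have : b j ≤ ∑ j, b j := Finset.single_le_sum (fun _ _ => Nat.zero_le _) (Finset.mem_univ j)
        rw [Finset.mem_range]
        omega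
      · intro b _ hb
        rw [if_neg]
        intro hc
        apply hb
        rw [Finset.Nat.mem_antidiagonalTuple, ← W_content, hc]
        omega
    rw [hsum]
    have : ((dg m).factorial : ℚ) ≠ 0 := by exact_mod_cast Nat.factorial_ne_zero _
    field_simp
  · rw [if_neg hW, Finset.sum_eq_zero, mul_zero, mul_zero]
    intro b hb
    rw [if_neg]
    intro hc
    rw [Finset.Nat.mem_antidiagonalTuple, ← W_content, hc] at hb
    omega

/-! ### Power series -/

/-- `1/(1-t_1)`. -/
def U : MvPowerSeries ℕ ℚ := (1 - MvPowerSeries.X 1 : MvPowerSeries ℕ ℚ)⁻¹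

lemma U_mul : (1 - MvPowerSeries.X 1 : MvPowerSeries ℕ ℚ) * U = 1 := by
  unfold U
  apply MvPowerSeries.mul_inv_cancel
  simp

/-- Explicit powers of `U`. -/
def V (N : ℕ) : MvPowerSeries ℕ ℚ :=
  fun m => if m = Finsupp.single 1 (m 1) then ((N + m 1).choose N : ℚ) else 0

lemma coeff_V (N : ℕ) (m : ℕ →₀ ℕ) : MvPowerSeries.coeff m (V N) =
    if m = Finsupp.single 1 (m 1) then ((N + m 1).choose N : ℚ) else 0 := rfl

lemma coeff_X_mul_V (N : ℕ) (m : ℕ →₀ ℕ) :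
    MvPowerSeries.coeff m (MvPowerSeries.X 1 * V N) =
    if m = Finsupp.single 1 (m 1) ∧ m 1 ≠ 0 then ((N + m 1 - 1).choose N : ℚ) else 0 := by
  rw [MvPowerSeries.X, MvPowerSeries.coeff_monomial_mul, coeff_V, one_mul]
  by_cases h : m 1 = 0
  · rw [if_neg, if_neg]
    · simp [h]
    · simp [Finsupp.single_le_iff, h]
  · rw [if_pos (by rw [Finsupp.single_le_iff]; omega)]
    have h1 : (m - Finsupp.single 1 1 : ℕ →₀ ℕ) 1 = m 1 - 1 := by simp
    have h2 : (m - Finsupp.single 1 1 = Finsupp.single 1 (m 1 - 1)) ↔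
        (m = Finsupp.single 1 (m 1) ∧ m 1 ≠ 0) := by
      constructor
      · intro hh
        refine ⟨?_, h⟩
        have hle : Finsupp.single 1 1 ≤ m := by rw [Finsupp.single_le_iff]; omega
        calc m = m - Finsupp.single 1 1 + Finsupp.single 1 1 := (tsub_add_cancel_of_le hle).symm
          _ = _ := by
            rw [hh, ← Finsupp.single_add]
            congr 1
            omega
      · rintro ⟨hh, -⟩
        conv_lhs => rw [hh]
        rw [← Finsupp.single_tsub]
    rw [h1]
    simp only [h2]
    have : N + (m 1 - 1) = N + m 1 - 1 := by omega
    rw [this]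

lemma V_zero : (1 - MvPowerSeries.X 1) * V 0 = 1 := by
  ext m
  rw [sub_mul, one_mul, map_sub, coeff_X_mul_V, coeff_V, MvPowerSeries.coeff_one]
  by_cases h1 : m = Finsupp.single 1 (m 1)
  · by_cases h2 : m 1 = 0
    · have : m = 0 := by rw [h1, h2]; simp
      simp [this]
    · have : m ≠ 0 := by rintro rfl; simp at h2
      simp [← h1, h2, this]
  · have : m ≠ 0 := by rintro rfl; simp at h1
    simp [h1, this]

lemma V_succ (N : ℕ) : (1 - MvPowerSeries.X 1) * V (N + 1) = V N := by
  ext m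
  rw [sub_mul, one_mul, map_sub, coeff_X_mul_V, coeff_V, coeff_V]
  by_cases h1 : m = Finsupp.single 1 (m 1)
  · by_cases h2 : m 1 = 0
    · simp [← h1, h2]
    · obtain ⟨k, hk⟩ := Nat.exists_eq_succ_of_ne_zero h2
      rw [if_pos h1, if_pos ⟨h1, h2⟩, if_pos h1, hk]
      have e1 : N + 1 + k.succ = (N + k.succ) + 1 := by omega
      have e2 : N + 1 + k.succ - 1 = N + k.succ := by omega
      rw [e2, e1, Nat.choose_succ_succ]
      push_cast
      ring
  · simp [h1]

lemma U_pow (N : ℕ) : U ^ (N + 1) = V N := by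
  induction N with
  | zero =>
    calc U ^ (0 + 1) = U * ((1 - MvPowerSeries.X 1) * V 0) := by rw [V_zero]; ring
      _ = ((1 - MvPowerSeries.X 1) * U) * V 0 := by ring
      _ = _ := by rw [U_mul, one_mul]
  | succ N ih =>
    calc U ^ (N + 1 + 1) = U * ((1 - MvPowerSeries.X 1) * V (N + 1)) := by
          rw [V_succ, ← ih]; ring
      _ = ((1 - MvPowerSeries.X 1) * U) * V (N + 1) := by ring
      _ = _ := by rw [U_mul, one_mul]

lemma prod_X (p : ℕ →₀ ℕ) : (p.prod fun i e => (MvPowerSeries.X i : MvPowerSeries ℕ ℚ) ^ e) =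
    MvPowerSeries.monomial p 1 := by
  have := congrArg (fun q : MvPolynomial ℕ ℚ => (q : MvPowerSeries ℕ ℚ))
    (MvPolynomial.monomial_eq (s := p) (a := (1 : ℚ)))
  simp only [map_one, one_mul, MvPolynomial.coe_monomial] at this
  rw [this, Finsupp.prod, Finsupp.prod]
  change _ = MvPolynomial.coeToMvPowerSeries.ringHom _
  rw [map_prod]
  simp

lemma coeff_term (n : ℕ) (p m : ℕ →₀ ℕ) (hn : 4 ≤ n) (hp : p 1 = 0) :
    MvPowerSeries.coeff m (term n U MvPowerSeries.X p) =
    if p = m.erase 1 then ((n + dg p - 3).factorial : ℚ) / D p *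
      ((n + dg p - 3 + m 1).choose (n + dg p - 3) : ℚ) else 0 := by
  unfold term
  have e : n + dg p - 2 = (n + dg p - 3) + 1 := by omega
  rw [prod_X, e, U_pow, MvPowerSeries.algebraMap_apply, Algebra.algebraMap_self, RingHom.id_apply,
    mul_assoc, MvPowerSeries.coeff_C_mul, MvPowerSeries.coeff_mul_monomial, mul_one, coeff_V]
  by_cases h : p = m.erase 1
  · have hle : p ≤ m := by
      intro i
      rw [h, Finsupp.erase_apply]
      split_ifs <;> simp
    have hsub : m - p = Finsupp.single 1 (m 1) := by
      ext i
      rw [Finsupp.tsub_apply, h, Finsupp.erase_apply, Finsupp.single_apply]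
      split_ifs <;> grind
    rw [if_pos hle, if_pos h, hsub]
    simp
  · rw [if_neg h]
    by_cases hle : p ≤ m
    · rw [if_pos hle, if_neg, mul_zero]
      intro hh
      apply h
      ext i
      have := DFunLike.congr_fun hh i
      have hi := hle i
      rw [Finsupp.tsub_apply, Finsupp.single_apply] at this
      rw [Finsupp.erase_apply]
      split_ifs at this ⊢ with h1 h2 h3
      · rw [h1, hp]
      · omega
      · omega
      · omega
    · rw [if_neg hle, mul_zero]

lemma sCorr_eq (n : ℕ) (hn : 4 ≤ n) : sCorr n = S n U MvPowerSeries.X := by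
  ext m
  change sCorr n m = _
  rw [coeff_sCorr n hn]
  unfold S
  rw [map_sum, Finset.sum_congr rfl fun p hp => coeff_term n p m hn (mem_F.1 hp).2.1,
    Finset.sum_ite_eq']
  have hm : m = Finsupp.single 1 (m 1) + m.erase 1 := (Finsupp.single_add_erase 1 m).symm
  have hW : W m = m 1 + W (m.erase 1) := by
    conv_lhs => rw [hm]
    rw [W_add, W_single, one_mul]
  have hd : dg m = m 1 + dg (m.erase 1) := by
    conv_lhs => rw [hm]
    rw [dg_add, dg_single]
  have hD : D m = (m 1).factorial * D (m.erase 1) := by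
    unfold D
    rw [← Finsupp.mul_prod_erase' m 1 _ (by simp)]
    simp
  have hiff : (m 0 = 0 ∧ W m + 3 = n + dg m) ↔ m.erase 1 ∈ F n := by
    rw [mem_F, cond, hW, hd]
    simp [Finsupp.erase_apply]
    intro _
    omega
  by_cases h : m.erase 1 ∈ F n
  · rw [if_pos (hiff.2 h), if_pos h, hD, hd]
    set N := n + dg (m.erase 1) - 3 with hN
    have e : n + (m 1 + dg (m.erase 1)) - 3 = N + m 1 := by omega
    rw [e, ← Nat.add_choose_mul_factorial_mul_factorial N (m 1), Nat.choose_symm_add]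
    have : ((m 1).factorial : ℚ) ≠ 0 := by exact_mod_cast Nat.factorial_ne_zero _
    push_cast
    field_simp
  · rw [if_neg (fun h' => h (hiff.1 h')), if_neg h]

/-! ### Part 1 -/

lemma part1 (n : ℕ) (hn : 4 ≤ n) : sCorr n ∈ Algebra.adjoin ℚ
        (insert ((1 - MvPowerSeries.X 1 : MvPowerSeries ℕ ℚ)⁻¹)
          {p : MvPowerSeries ℕ ℚ | ∃ i : ℕ, 2 ≤ i ∧ p = MvPowerSeries.X i}) := by
  rw [sCorr_eq n hn]
  refine Subalgebra.sum_mem _ fun m hm => term_mem _ _ _ _ _ ?_ ?_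
  · exact Algebra.subset_adjoin (Set.mem_insert _ _)
  · intro i hi
    exact Algebra.subset_adjoin (Set.mem_insert_of_mem _ ⟨i, cond_support (mem_F.1 hm) i hi, rfl⟩)

/-! ### Part 3 -/

/-- Elements which lie in `A` after multiplication by a power of `v ∈ A`. -/
def satur {R : Type*} [CommRing R] [Algebra ℚ R] (A : Subalgebra ℚ R) (v : R) (hv : v ∈ A) :
    Subalgebra ℚ R where
  carrier := {f | ∃ e : ℕ, v ^ e * f ∈ A}
  mul_mem' := by
    rintro a b ⟨e, he⟩ ⟨e', he'⟩
    refine ⟨e + e', ?_⟩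
    have := A.mul_mem he he'
    convert this using 1
    ring
  add_mem' := by
    rintro a b ⟨e, he⟩ ⟨e', he'⟩
    refine ⟨e + e', ?_⟩
    have := A.add_mem (A.mul_mem (A.pow_mem hv e') he) (A.mul_mem (A.pow_mem hv e) he')
    convert this using 1
    ring
  algebraMap_mem' r := ⟨0, by simp⟩

lemma part3 (i : ℕ) (hi : 2 ≤ i) : ∃ g : Polynomial ℚ, g ≠ 0 ∧
      Polynomial.aeval (MvPowerSeries.X 1 : MvPowerSeries ℕ ℚ) g * MvPowerSeries.X i ∈
        Algebra.adjoin ℚ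
          (insert (MvPowerSeries.X 1 : MvPowerSeries ℕ ℚ)
            {p : MvPowerSeries ℕ ℚ | ∃ n : ℕ, 4 ≤ n ∧ p = sCorr n}) := by
  set A := Algebra.adjoin ℚ (insert (MvPowerSeries.X 1 : MvPowerSeries ℕ ℚ)
            {p : MvPowerSeries ℕ ℚ | ∃ n : ℕ, 4 ≤ n ∧ p = sCorr n}) with hA
  have hX : MvPowerSeries.X 1 ∈ A := Algebra.subset_adjoin (Set.mem_insert _ _)
  have hs : ∀ n, 4 ≤ n → sCorr n ∈ A := fun n hn =>
    Algebra.subset_adjoin (Set.mem_insert_of_mem _ ⟨n, hn, rfl⟩)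
  have hv : (1 - MvPowerSeries.X 1) ∈ A := A.sub_mem A.one_mem hX
  let L := satur A _ hv
  have hAL : ∀ f ∈ A, f ∈ L := fun f hf => ⟨0, by simpa using hf⟩
  have hU : U ∈ L := ⟨1, by rw [pow_one, U_mul]; exact A.one_mem⟩
  have main : ∀ i, 2 ≤ i → (MvPowerSeries.X i : MvPowerSeries ℕ ℚ) ∈ L := by
    intro i
    induction i using Nat.strong_induction_on with
    | _ i ih =>
      intro hi
      have h1 := S_eq (i + 2) (by omega) U (MvPowerSeries.X : ℕ → MvPowerSeries ℕ ℚ)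
      rw [← sCorr_eq _ (by omega)] at h1
      have e1 : i + 2 - 1 = i + 1 := by omega
      have e2 : i + 2 - 2 = i := by omega
      rw [e1, e2] at h1
      have hr : rest (i + 2) U (MvPowerSeries.X : ℕ → MvPowerSeries ℕ ℚ) ∈ L := by
        refine Subalgebra.sum_mem _ fun m hm => term_mem _ _ _ _ _ hU fun j hj => ?_
        have := rest_support hm j hj
        exact ih j (by omega) this.1
      have h2 : (MvPowerSeries.X i : MvPowerSeries ℕ ℚ) = (1 - MvPowerSeries.X 1) ^ (i + 1) *
          (sCorr (i + 2) - rest (i + 2) U MvPowerSeries.X) := by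
        rw [h1, add_sub_cancel_right, ← mul_assoc, ← mul_pow, U_mul, one_pow, one_mul]
      rw [h2]
      exact L.mul_mem (L.pow_mem (hAL _ hv) _) (L.sub_mem (hAL _ (hs _ (by omega))) hr)
  obtain ⟨e, he⟩ := main i hi
  refine ⟨(1 - Polynomial.X) ^ e, pow_ne_zero _ ?_, ?_⟩
  · intro h
    have := congrArg (Polynomial.eval 0) h
    simp at this
  · simpa using he

/-! ### Part 2 -/

/-- index type -/
abbrev I := Option {n : ℕ // 4 ≤ n}

/-- target field -/
abbrev K := FractionRing (MvPolynomial I ℚ)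

/-- variables -/
def y (i : I) : K := algebraMap (MvPolynomial I ℚ) K (MvPolynomial.X i)

/-- The recursive solution for `t_i`. -/
def tau : ℕ → K
  | i =>
    if h : 2 ≤ i then
      (1 - y none) ^ (i + 1) * (y (some ⟨i + 2, by omega⟩) -
        rest (i + 2) (1 - y none)⁻¹ (fun j => if _h : j < i then tau j else 0))
    else y none

lemma tau_one : tau 1 = y none := by
  rw [tau]; simp

lemma y_ne : (1 - y none : K) ≠ 0 := by
  have : (1 - y none : K) = algebraMap (MvPolynomial I ℚ) K (1 - MvPolynomial.X none) := by
    simp [y]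
  rw [this]
  intro h
  rw [map_eq_zero_iff _ (IsFractionRing.injective (MvPolynomial I ℚ) K)] at h
  have := congrArg (MvPolynomial.eval (0 : I → ℚ)) h
  simp at this

lemma S_tau (n : ℕ) (hn : 4 ≤ n) : S n (1 - y none)⁻¹ tau = y (some ⟨n, hn⟩) := by
  obtain ⟨i, rfl⟩ : ∃ i, n = i + 2 := ⟨n - 2, by omega⟩
  rw [S_eq _ hn]
  have e1 : i + 2 - 1 = i + 1 := by omega
  have e2 : i + 2 - 2 = i := by omega
  rw [e1, e2]
  have h : tau i = (1 - y none) ^ (i + 1) * (y (some ⟨i + 2, by omega⟩) -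
        rest (i + 2) (1 - y none)⁻¹ tau) := by
    conv_lhs => rw [tau]
    rw [dif_pos (by omega)]
    congr 2
    refine rest_congr _ _ _ _ fun j _ hj => ?_
    rw [dif_pos (by omega)]
  rw [h, ← mul_assoc, ← mul_pow, inv_mul_cancel₀ y_ne, one_pow, one_mul]
  ring

/-- localized polynomial ring -/
abbrev B := Localization.Away (1 - MvPolynomial.X 1 : MvPolynomial ℕ ℚ)

/-- to power series -/
def iota : B →ₐ[ℚ] MvPowerSeries ℕ ℚ :=
  IsLocalization.liftAlgHom (M := Submonoid.powers (1 - MvPolynomial.X 1 : MvPolynomial ℕ ℚ))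
    (f := MvPolynomial.aeval (MvPowerSeries.X : ℕ → MvPowerSeries ℕ ℚ)) (by
      rintro ⟨_, e, rfl⟩
      simp only [map_pow, map_sub, map_one, MvPolynomial.aeval_X]
      exact (IsUnit.of_mul_eq_one _ U_mul).pow e)

/-- to the fraction field -/
def psi : B →ₐ[ℚ] K :=
  IsLocalization.liftAlgHom (M := Submonoid.powers (1 - MvPolynomial.X 1 : MvPolynomial ℕ ℚ))
    (f := MvPolynomial.aeval tau) (by
      rintro ⟨_, e, rfl⟩
      simp only [map_pow, map_sub, map_one, MvPolynomial.aeval_X, tau_one]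
      exact (isUnit_iff_ne_zero.2 y_ne).pow e)

/-- variables in `B` -/
def tB (i : ℕ) : B := algebraMap (MvPolynomial ℕ ℚ) B (MvPolynomial.X i)

/-- inverse in `B` -/
def uB : B := IsLocalization.Away.invSelf (1 - MvPolynomial.X 1 : MvPolynomial ℕ ℚ)

lemma uB_mul : (1 - tB 1) * uB = 1 := by
  have := IsLocalization.Away.mul_invSelf (S := B) (1 - MvPolynomial.X 1 : MvPolynomial ℕ ℚ)
  simpa [tB, uB] using this

lemma iota_tB (i : ℕ) : iota (tB i) = MvPowerSeries.X i := by
  simp [iota, tB]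

lemma psi_tB (i : ℕ) : psi (tB i) = tau i := by
  simp [psi, tB]

lemma iota_uB : iota uB = U := by
  have := congrArg iota uB_mul
  rw [map_mul, map_sub, map_one, iota_tB] at this
  calc iota uB = ((1 - MvPowerSeries.X 1) * U) * iota uB := by rw [U_mul, one_mul]
    _ = U * ((1 - MvPowerSeries.X 1) * iota uB) := by ring
    _ = U := by rw [this, mul_one]

lemma psi_uB : psi uB = (1 - y none)⁻¹ := by
  have := congrArg psi uB_mul
  rw [map_mul, map_sub, map_one, psi_tB, tau_one] at this
  exact eq_inv_of_mul_eq_one_right this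

lemma iota_injective : Function.Injective iota := by
  rw [injective_iff_map_eq_zero]
  intro z hz
  obtain ⟨⟨p, s⟩, hps⟩ :=
    IsLocalization.surj (Submonoid.powers (1 - MvPolynomial.X 1 : MvPolynomial ℕ ℚ)) z
  have h1 := congrArg iota hps
  rw [map_mul, hz, zero_mul] at h1
  have h2 : iota (algebraMap _ _ p) = (p : MvPowerSeries ℕ ℚ) := by
    have : iota (algebraMap _ _ p) = MvPolynomial.aeval MvPowerSeries.X p := by simp [iota]
    rw [this]
    have h3 : (MvPolynomial.aeval (MvPowerSeries.X : ℕ → MvPowerSeries ℕ ℚ)) =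
        MvPolynomial.coeToMvPowerSeries.algHom (σ := ℕ) (R := ℚ) ℚ := by
      ext i : 1
      simp
    rw [h3]
    simp
  simp only at h1
  rw [h2] at h1
  have hp : p = 0 := by
    apply MvPolynomial.coe_injective
    simpa using h1.symm
  simp only [hp, map_zero] at hps
  exact (IsUnit.mul_left_eq_zero (IsLocalization.map_units B s)).1 hps

/-- The family in `B`. -/
def famB (x : I) : B := x.elim (tB 1) (fun n => S n.1 uB tB)

lemma psi_famB (x : I) : psi (famB x) = y x := by
  rcases x with _ | n
  · simp [famB, psi_tB, tau_one]
  · simp only [famB, Option.elim]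
    rw [map_S, psi_uB]
    simp only [psi_tB]
    exact S_tau n.1 n.2

lemma iota_famB (x : I) : iota (famB x) =
    x.elim (MvPowerSeries.X 1 : MvPowerSeries ℕ ℚ) (fun n => sCorr n.1) := by
  rcases x with _ | n
  · simp [famB, iota_tB]
  · simp only [famB, Option.elim]
    rw [map_S, iota_uB, sCorr_eq n.1 n.2]
    simp only [iota_tB]

lemma part2 : AlgebraicIndependent ℚ
      (fun x : Option {n : ℕ // 4 ≤ n} =>
        x.elim (MvPowerSeries.X 1 : MvPowerSeries ℕ ℚ) (fun n => sCorr n.1)) := by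
  rw [algebraicIndependent_iff]
  intro P hP
  have h1 : MvPolynomial.aeval famB P = 0 := by
    apply iota_injective
    rw [map_zero, ← hP, MvPolynomial.comp_aeval_apply]
    simp only [iota_famB]
  have h2 := congrArg psi h1
  rw [map_zero, MvPolynomial.comp_aeval_apply] at h2
  simp only [psi_famB] at h2
  have h3 : MvPolynomial.aeval (fun x => y x) P = algebraMap (MvPolynomial I ℚ) K P := by
    have : (MvPolynomial.aeval (fun x => y x) : MvPolynomial I ℚ →ₐ[ℚ] K) =
        IsScalarTower.toAlgHom ℚ (MvPolynomial I ℚ) K := by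
      ext i : 1
      simp [y]
    rw [this]
    rfl
  rw [h3] at h2
  exact (map_eq_zero_iff _ (IsFractionRing.injective (MvPolynomial I ℚ) K)).1 h2

end Stmt16

theorem stmt16 :
    -- s_n ∈ ℚ[1/(1−t_1)][t_2,t_3,…] for n ≥ 4
    (∀ n : ℕ, 4 ≤ n →
      sCorr n ∈ Algebra.adjoin ℚ
        (insert ((1 - MvPowerSeries.X 1 : MvPowerSeries ℕ ℚ)⁻¹)
          {p : MvPowerSeries ℕ ℚ | ∃ i : ℕ, 2 ≤ i ∧ p = MvPowerSeries.X i})) ∧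
    -- injectivity: t_1 together with the s_n (n ≥ 4) is algebraically
    -- independent over ℚ, i.e. the s_n are algebraically independent over ℚ(t_1)
    AlgebraicIndependent ℚ
      (fun x : Option {n : ℕ // 4 ≤ n} =>
        x.elim (MvPowerSeries.X 1 : MvPowerSeries ℕ ℚ) (fun n => sCorr n.1)) ∧
    -- surjectivity: each t_i (i ≥ 2) is a polynomial in the s_n with
    -- coefficients in ℚ(t_1)
    (∀ i : ℕ, 2 ≤ i → ∃ g : Polynomial ℚ, g ≠ 0 ∧
      Polynomial.aeval (MvPowerSeries.X 1 : MvPowerSeries ℕ ℚ) g * MvPowerSeries.X i ∈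
        Algebra.adjoin ℚ
          (insert (MvPowerSeries.X 1 : MvPowerSeries ℕ ℚ)
            {p : MvPowerSeries ℕ ℚ | ∃ n : ℕ, 4 ≤ n ∧ p = sCorr n})) := by
  exact ⟨Stmt16.part1, Stmt16.part2, Stmt16.part3⟩

end
end

section
/- Explicit evaluations of low-point genus 0 correlators at t_0 = 0: For n ≥ 3 let s_n ∈ ℚ[[t_1,t_2,…]] be defined by s_n = Σ_{k≥0} (1/k!) Σ_{b_1,…,b_k ≥ 1, b_1+⋯+b_k = n+k−3} [(n+k−3)!/(b_1!⋯b_k!)] t_{b_1}⋯t_{b_k}. Then the following identities hold in ℚ[[t_1,t_2,…]]: (1−t_1)·s_3 = 1; (1−t_1)^3·s_4 = t_2; (1−t_1)^5·s_5 = t_3(1−t_1) + 3t_2^2; and (1−t_1)^7·s_6 = t_4(1−t_1)^2 + 10 t_2 t_3 (1−t_1) + 15 t_2^3. -/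
/-!
STATEMENT 17: Explicit evaluations of low-point genus 0 correlators at t_0 = 0:
(1−t_1)·s_3 = 1, (1−t_1)³·s_4 = t_2, (1−t_1)⁵·s_5 = t_3(1−t_1) + 3t_2²,
(1−t_1)⁷·s_6 = t_4(1−t_1)² + 10t_2t_3(1−t_1) + 15t_2³.
-/

noncomputable section

open Finsupp in
lemma prodX (k : ℕ) (b : Fin k → ℕ) : ∏ j, (MvPolynomial.X (b j) : MvPolynomial ℕ ℚ) =
    MvPolynomial.monomial (∑ j, Finsupp.single (b j) 1) 1 := by
  rw [MvPolynomial.monomial_sum_one]; rfl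

lemma corr_coeff (n : ℕ) (hn : 3 ≤ n) (m : ℕ →₀ ℕ) (k : ℕ) (hk : (m.sum fun _ e => e) = k) :
    corr n (fun _ => 0) m = ((k.factorial : ℚ)⁻¹) *
      ∑ b ∈ Finset.Nat.antidiagonalTuple k (n + k - 3),
        if (∑ j, Finsupp.single (b j) 1) = m then
          ((n + k - 3).factorial : ℚ) / ∏ j, ((b j).factorial : ℚ) else 0 := by
  unfold corr corrPoly
  rw [hk, if_pos ⟨by omega, by simp⟩]
  simp [prodX, MvPolynomial.coeff_sum, MvPolynomial.coeff_C_mul, MvPolynomial.coeff_monomial]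

/-- The exponent `t_1^a t_2^b t_3^c t_4^d`. -/
def mk4 (a b c d : ℕ) : ℕ →₀ ℕ :=
  Finsupp.single 1 a + Finsupp.single 2 b + Finsupp.single 3 c + Finsupp.single 4 d

lemma mk4_sum (a b c d : ℕ) {M : Type*} [AddCommMonoid M] (f : ℕ → ℕ → M) (h0 : ∀ i, f i 0 = 0)
    (h : ∀ i x y, f i (x + y) = f i x + f i y) :
    (mk4 a b c d).sum f = f 1 a + f 2 b + f 3 c + f 4 d := by
  unfold mk4
  rw [Finsupp.sum_add_index' h0 h, Finsupp.sum_add_index' h0 h, Finsupp.sum_add_index' h0 h]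
  simp [Finsupp.sum_single_index, h0]

lemma mk4_apply (a b c d i : ℕ) : mk4 a b c d i = if i = 1 then a else if i = 2 then b else
    if i = 3 then c else if i = 4 then d else 0 := by
  unfold mk4
  simp only [Finsupp.add_apply, Finsupp.single_apply]
  split_ifs <;> omega

lemma mk4_inj {a b c d a' b' c' d' : ℕ} : mk4 a b c d = mk4 a' b' c' d' ↔
    a = a' ∧ b = b' ∧ c = c' ∧ d = d' := by
  constructor
  · intro h
    have h1 := DFunLike.congr_fun h 1
    have h2 := DFunLike.congr_fun h 2
    have h3 := DFunLike.congr_fun h 3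
    have h4 := DFunLike.congr_fun h 4
    simp [mk4_apply] at h1 h2 h3 h4
    exact ⟨h1, h2, h3, h4⟩
  · rintro ⟨rfl, rfl, rfl, rfl⟩; rfl

lemma mk4_of (m : ℕ →₀ ℕ) (h : ∀ i, m i ≠ 0 → 1 ≤ i ∧ i ≤ 4) :
    m = mk4 (m 1) (m 2) (m 3) (m 4) := by
  ext i
  rw [mk4_apply]
  split_ifs with h1 h2 h3 h4
  · rw [h1]
  · rw [h2]
  · rw [h3]
  · rw [h4]
  · by_contra h5
    have := h i h5
    omega

lemma sum_of_tuple (k : ℕ) (b : Fin k → ℕ) :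
    (∑ j, Finsupp.single (b j) 1).sum (fun i e => e * i) = ∑ j, b j := by
  rw [← Finsupp.sum_finsetSum_index (by simp) (by intros; ring)]
  simp [Finsupp.sum_single_index]

lemma prod_of_tuple (k : ℕ) (b : Fin k → ℕ) :
    (∑ j, Finsupp.single (b j) 1).prod (fun i e => (i.factorial : ℚ) ^ e) =
      ∏ j, ((b j).factorial : ℚ) := by
  rw [← Finsupp.prod_finsetSum_index (by simp) (by intros; ring)]
  simp [Finsupp.prod_single_index]

lemma tuple_apply (k : ℕ) (b : Fin k → ℕ) (j : Fin k) :
    (∑ j, Finsupp.single (b j) 1 : ℕ →₀ ℕ) (b j) ≠ 0 := by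
  rw [Finsupp.finsetSum_apply]
  intro h
  rw [Finset.sum_eq_zero_iff] at h
  simpa using h j (Finset.mem_univ _)

lemma tuple_apply' (k : ℕ) (b : Fin k → ℕ) (i : ℕ)
    (h : (∑ j, Finsupp.single (b j) 1 : ℕ →₀ ℕ) i ≠ 0) : ∃ j, b j = i := by
  by_contra hc
  push Not at hc
  apply h
  rw [Finsupp.finsetSum_apply]
  exact Finset.sum_eq_zero fun j _ => by simp [hc j]

lemma count (a b c d k : ℕ) (hk : k = a + b + c + d) :
    ∑ β ∈ Fintype.piFinset (fun _ : Fin k => ({1,2,3,4} : Finset ℕ)),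
      (if (∑ j, Finsupp.single (β j) 1) = mk4 a b c d then (1 : ℚ) else 0) =
    (k.factorial : ℚ) / (a.factorial * b.factorial * c.factorial * d.factorial) := by
  have h1 : (∑ i ∈ ({1,2,3,4} : Finset ℕ), (MvPolynomial.X i : MvPolynomial ℕ ℚ)) ^ k =
      ∑ β ∈ Fintype.piFinset (fun _ : Fin k => ({1,2,3,4} : Finset ℕ)),
        ∏ j, MvPolynomial.X (β j) := by
    rw [← Finset.prod_univ_sum]; simp
  have h2 := congrArg (MvPolynomial.coeff (mk4 a b c d)) h1
  simp only [prodX, MvPolynomial.coeff_sum, MvPolynomial.coeff_monomial] at h2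
  rw [← h2, Finset.sum_pow_eq_sum_piAntidiag, MvPolynomial.coeff_sum]
  have h3 : ∀ κ : ℕ → ℕ, ∏ i ∈ ({1,2,3,4} : Finset ℕ), (MvPolynomial.X i : MvPolynomial ℕ ℚ) ^ κ i
      = MvPolynomial.monomial (mk4 (κ 1) (κ 2) (κ 3) (κ 4)) 1 := by
    intro κ
    simp [mk4, MvPolynomial.X_pow_eq_monomial, MvPolynomial.monomial_mul, add_assoc]
  simp only [h3]
  have h4 : ∀ r : ℕ, (r : MvPolynomial ℕ ℚ) = MvPolynomial.C (r : ℚ) := by intro r; simp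
  simp only [h4, MvPolynomial.coeff_C_mul, MvPolynomial.coeff_monomial]
  rw [Finset.sum_eq_single (⇑(mk4 a b c d))]
  · rw [if_pos (by simp [mk4_apply])]
    have := Nat.multinomial_spec ({1,2,3,4} : Finset ℕ) (mk4 a b c d)
    have e1 : ∏ i ∈ ({1,2,3,4} : Finset ℕ), (mk4 a b c d i).factorial =
      a.factorial * b.factorial * c.factorial * d.factorial := by simp [mk4_apply, mul_assoc]
    have e2 : ∑ i ∈ ({1,2,3,4} : Finset ℕ), (mk4 a b c d i) = k := by
      simp [mk4_apply]; omega
    rw [e1, e2] at this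
    rw [← this]
    push_cast
    have := a.factorial_ne_zero
    have := b.factorial_ne_zero
    have := c.factorial_ne_zero
    have := d.factorial_ne_zero
    field_simp
  · intro κ hκ hne
    rw [if_neg, mul_zero]
    intro h
    apply hne
    rw [mk4_inj] at h
    rw [Finset.mem_piAntidiag] at hκ
    funext i
    rw [mk4_apply]
    split_ifs with h1 h2 h3 h4
    · rw [h1, h.1]
    · rw [h2, h.2.1]
    · rw [h3, h.2.2.1]
    · rw [h4, h.2.2.2]
    · by_contra h5
      have := hκ.2 i h5
      simp at this
      omega
  · intro hn
    exfalso
    apply hn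
    rw [Finset.mem_piAntidiag]
    refine ⟨by simp [mk4_apply]; omega, ?_⟩
    intro i hi
    rw [mk4_apply] at hi
    simp
    split_ifs at hi <;> omega

lemma sCorr_mk4 (n : ℕ) (a b c d : ℕ) :
    sCorr (n + 3) (mk4 a b c d) = if b + 2 * c + 3 * d = n then
      ((n + a + b + c + d).factorial : ℚ) /
        (a.factorial * b.factorial * c.factorial * d.factorial * (2 ^ b * 6 ^ c * 24 ^ d))
      else 0 := by
  have hk : ((mk4 a b c d).sum fun _ e => e) = a + b + c + d :=
    mk4_sum a b c d _ (by simp) (by simp)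
  have hw : ((mk4 a b c d).sum fun i e => e * i) = a + 2 * b + 3 * c + 4 * d := by
    rw [mk4_sum a b c d _ (by simp) (by intros; ring)]; ring
  have hp : ((mk4 a b c d).prod fun i e => (i.factorial : ℚ) ^ e) = 2 ^ b * 6 ^ c * 24 ^ d := by
    have h0 : ∀ i : ℕ, (i.factorial : ℚ) ^ 0 = 1 := by simp
    have h : ∀ i x y : ℕ, (i.factorial : ℚ) ^ (x + y) = (i.factorial : ℚ) ^ x * (i.factorial : ℚ) ^ y := by
      intros; ring
    unfold mk4
    rw [Finsupp.prod_add_index' h0 h, Finsupp.prod_add_index' h0 h, Finsupp.prod_add_index' h0 h]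
    simp [Finsupp.prod_single_index, Nat.factorial]
  unfold sCorr
  rw [if_pos (by simp [mk4_apply]), corr_coeff (n+3) (by omega) _ _ hk]
  have hs : n + 3 + (a + b + c + d) - 3 = n + a + b + c + d := by omega
  rw [hs]
  split_ifs with hc
  · have key : (∑ β ∈ Finset.Nat.antidiagonalTuple (a + b + c + d) (n + a + b + c + d),
        if (∑ j, Finsupp.single (β j) 1) = mk4 a b c d then
          ((n + a + b + c + d).factorial : ℚ) / ∏ j, ((β j).factorial : ℚ) else 0) =
        ∑ β ∈ Fintype.piFinset (fun _ : Fin (a + b + c + d) => ({1,2,3,4} : Finset ℕ)),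
      ((n + a + b + c + d).factorial : ℚ) / (2 ^ b * 6 ^ c * 24 ^ d) *
      (if (∑ j, Finsupp.single (β j) 1) = mk4 a b c d then (1 : ℚ) else 0) := by
      simp only [mul_ite, mul_one, mul_zero]
      rw [← Finset.sum_filter, ← Finset.sum_filter]
      apply Finset.sum_congr
      · ext β
        simp only [Finset.mem_filter, Finset.Nat.mem_antidiagonalTuple, Fintype.mem_piFinset]
        apply and_congr_left
        intro h
        have hb := sum_of_tuple _ β
        rw [h, hw] at hb
        constructor
        · intro _ j
          have := tuple_apply _ β j
          rw [h, mk4_apply] at this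
          simp
          split_ifs at this <;> omega
        · intro _
          omega
      · intro β hβ
        rw [← prod_of_tuple, (Finset.mem_filter.1 hβ).2, hp]
    rw [key, ← Finset.mul_sum, count a b c d _ rfl]
    have := (a+b+c+d).factorial_ne_zero
    field_simp
  · rw [Finset.sum_eq_zero, mul_zero]
    intro β hβ
    rw [if_neg]
    intro h
    have hb := sum_of_tuple _ β
    rw [h, hw] at hb
    rw [Finset.Nat.mem_antidiagonalTuple] at hβ
    omega

lemma sCorr_other (n : ℕ) (hn : n ≤ 3) (m : ℕ →₀ ℕ) (hm : ∀ a b c d, m ≠ mk4 a b c d) :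
    sCorr (n + 3) m = 0 := by
  unfold sCorr
  split_ifs with h0
  · rw [corr_coeff (n+3) (by omega) _ _ rfl, Finset.sum_eq_zero, mul_zero]
    intro β hβ
    rw [if_neg]
    intro h
    apply hm (m 1) (m 2) (m 3) (m 4)
    apply mk4_of
    rw [Finset.Nat.mem_antidiagonalTuple] at hβ
    have hpos : ∀ j, 1 ≤ β j := by
      intro j
      by_contra hc
      have := tuple_apply _ β j
      rw [h] at this
      exact this (by rw [show β j = 0 by omega, h0])
    intro i hi
    rw [← h] at hi
    obtain ⟨j, rfl⟩ := tuple_apply' _ β i hi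
    refine ⟨hpos j, ?_⟩
    have h1 : ∑ j, β j = ∑ j, (β j - 1) + ∑ _j : Fin (m.sum fun _ e => e), 1 := by
      rw [← Finset.sum_add_distrib]
      exact Finset.sum_congr rfl fun j _ => by have := hpos j; omega
    have h2 : β j - 1 ≤ ∑ j, (β j - 1) :=
      Finset.single_le_sum (f := fun j => β j - 1) (fun _ _ => Nat.zero_le _) (Finset.mem_univ j)
    simp at h1
    omega
  · rfl

/-- The series `(1 - t_1)^{-(d+1)}`. -/
def G (d : ℕ) : MvPowerSeries ℕ ℚ :=
  fun m => if m = Finsupp.single 1 (m 1) then ((d + m 1).choose d : ℚ) else 0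

lemma coeff_G (d : ℕ) (m : ℕ →₀ ℕ) : MvPowerSeries.coeff m (G d) =
    if m = Finsupp.single 1 (m 1) then ((d + m 1).choose d : ℚ) else 0 := rfl

lemma coeff_X_mul_G (d : ℕ) (m : ℕ →₀ ℕ) :
    MvPowerSeries.coeff m ((MvPowerSeries.X 1 : MvPowerSeries ℕ ℚ) * G d) =
    if m = Finsupp.single 1 (m 1) ∧ m 1 ≠ 0 then ((d + (m 1 - 1)).choose d : ℚ) else 0 := by
  rw [MvPowerSeries.X, MvPowerSeries.coeff_monomial_mul, coeff_G, one_mul]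
  by_cases h : m 1 = 0
  · rw [if_neg, if_neg (by tauto)]
    intro hle
    have := hle 1
    simp at this
    omega
  · have hle : Finsupp.single 1 1 ≤ m := by
      rw [Finsupp.single_le_iff]; omega
    rw [if_pos hle]
    have : (m - Finsupp.single 1 1 : ℕ →₀ ℕ) 1 = m 1 - 1 := by simp
    rw [this]
    congr 1
    rw [tsub_eq_iff_eq_add_of_le hle, ← Finsupp.single_add, Nat.sub_add_cancel (by omega)]
    simp [h]

lemma G_zero : (1 - (MvPowerSeries.X 1 : MvPowerSeries ℕ ℚ)) * G 0 = 1 := by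
  ext m
  rw [sub_mul, one_mul, map_sub, coeff_X_mul_G, coeff_G, MvPowerSeries.coeff_one]
  by_cases h0 : m = 0
  · subst h0; simp
  · by_cases h : m = Finsupp.single 1 (m 1)
    · have : m 1 ≠ 0 := by
        intro h1; rw [h1] at h; simp at h; exact h0 h
      rw [if_pos h, if_pos ⟨h, this⟩, if_neg h0]; simp
    · simp [h, h0]

lemma G_succ (d : ℕ) : (1 - (MvPowerSeries.X 1 : MvPowerSeries ℕ ℚ)) * G (d + 1) = G d := by
  ext m
  rw [sub_mul, one_mul, map_sub, coeff_X_mul_G, coeff_G, coeff_G]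
  by_cases h : m = Finsupp.single 1 (m 1)
  · rw [if_pos h, if_pos h]
    rcases hm : m 1 with _ | a
    · simp
    · rw [if_pos ⟨by rw [← hm]; exact h, by omega⟩]
      rw [show d + 1 + (a + 1) = (d + (a + 1)) + 1 by ring, Nat.choose_succ_succ,
        show d + 1 + (a + 1 - 1) = d + (a+1) by simp; ring]
      push_cast; simp
  · simp [h]

lemma G_pow (d : ℕ) : (1 - (MvPowerSeries.X 1 : MvPowerSeries ℕ ℚ)) ^ (d + 1) * G d = 1 := by
  induction d with
  | zero => simpa using G_zero
  | succ d ih => rw [pow_succ, mul_assoc, G_succ, ih]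

lemma G_pow' (d e : ℕ) : (1 - (MvPowerSeries.X 1 : MvPowerSeries ℕ ℚ)) ^ (e + (d + 1)) * G d =
    (1 - (MvPowerSeries.X 1 : MvPowerSeries ℕ ℚ)) ^ e := by
  rw [pow_add, mul_assoc, G_pow, mul_one]

/-- The basic summand. -/
def term (b c d N : ℕ) (r : ℚ) : MvPowerSeries ℕ ℚ :=
  MvPowerSeries.monomial (mk4 0 b c d) r * G N

lemma mk4_add (a b c d a' b' c' d' : ℕ) :
    mk4 a b c d + mk4 a' b' c' d' = mk4 (a+a') (b+b') (c+c') (d+d') := by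
  ext i
  simp only [Finsupp.add_apply, mk4_apply]
  split_ifs <;> rfl

lemma term_eq_mk4 (m : ℕ →₀ ℕ) (b c d a : ℕ) (hle : mk4 0 b c d ≤ m)
    (h : m - mk4 0 b c d = Finsupp.single 1 a) : m = mk4 a b c d := by
  rw [tsub_eq_iff_eq_add_of_le hle] at h
  rw [h, show Finsupp.single 1 a = mk4 a 0 0 0 by simp [mk4], mk4_add]
  simp

lemma term_other (m : ℕ →₀ ℕ) (b c d N : ℕ) (r : ℚ) (hm : ∀ a b c d, m ≠ mk4 a b c d) :
    MvPowerSeries.coeff m (term b c d N r) = 0 := by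
  rw [term, MvPowerSeries.coeff_monomial_mul, coeff_G]
  split_ifs with h1 h2
  · exact absurd (term_eq_mk4 _ _ _ _ _ h1 h2) (hm _ _ _ _)
  · simp
  · rfl

lemma term_mk4 (a b c d b' c' d' N : ℕ) (r : ℚ) :
    MvPowerSeries.coeff (mk4 a b c d) (term b' c' d' N r) =
      if b = b' ∧ c = c' ∧ d = d' then r * ((N + a).choose N : ℚ) else 0 := by
  by_cases h : b = b' ∧ c = c' ∧ d = d'
  · obtain ⟨rfl, rfl, rfl⟩ := h
    rw [if_pos ⟨rfl, rfl, rfl⟩, term,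
      show mk4 a b c d = mk4 0 b c d + Finsupp.single 1 a by
        rw [show Finsupp.single 1 a = mk4 a 0 0 0 by simp [mk4], mk4_add]; simp,
      MvPowerSeries.coeff_add_monomial_mul, coeff_G]
    simp
  · rw [if_neg h, term, MvPowerSeries.coeff_monomial_mul, coeff_G]
    split_ifs with h1 h2
    · have := term_eq_mk4 _ _ _ _ _ h1 h2
      rw [mk4_inj] at this
      exact absurd this.2 h
    · simp
    · rfl

lemma choose_val (N a : ℕ) : ((N + a).choose N : ℚ) = ((N + a).factorial : ℚ) / (N.factorial * a.factorial) := by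
  rw [Nat.cast_choose ℚ (Nat.le_add_right N a), Nat.add_sub_cancel_left]

lemma s3 : sCorr 3 = term 0 0 0 0 1 := by
  ext m
  by_cases hm : ∃ a b c d, m = mk4 a b c d
  · obtain ⟨a, b, c, d, rfl⟩ := hm
    rw [show MvPowerSeries.coeff (mk4 a b c d) (sCorr 3) = _ from sCorr_mk4 0 a b c d]
    simp only [term_mk4, choose_val]
    by_cases h : b + 2 * c + 3 * d = 0
    · obtain ⟨rfl, rfl, rfl⟩ : b = 0 ∧ c = 0 ∧ d = 0 := by omega
      simp
    · rw [if_neg h, if_neg (by omega)]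
  · push Not at hm
    rw [show MvPowerSeries.coeff m (sCorr 3) = _ from sCorr_other 0 (by omega) m hm]
    simp [term_other _ _ _ _ _ _ hm]

lemma s4 : sCorr 4 = term 1 0 0 2 1 := by
  ext m
  by_cases hm : ∃ a b c d, m = mk4 a b c d
  · obtain ⟨a, b, c, d, rfl⟩ := hm
    rw [show MvPowerSeries.coeff (mk4 a b c d) (sCorr 4) = _ from sCorr_mk4 1 a b c d]
    simp only [term_mk4, choose_val]
    by_cases h : b + 2 * c + 3 * d = 1
    · obtain ⟨rfl, rfl, rfl⟩ : b = 1 ∧ c = 0 ∧ d = 0 := by omega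
      rw [show 1 + a + 1 + 0 + 0 = 2 + a by ring]
      generalize (2 + a).factorial = x
      simp [Nat.factorial]
      ring
    · rw [if_neg h, if_neg (by omega)]
  · push Not at hm
    rw [show MvPowerSeries.coeff m (sCorr 4) = _ from sCorr_other 1 (by omega) m hm]
    simp [term_other _ _ _ _ _ _ hm]

lemma s5 : sCorr 5 = term 0 1 0 3 1 + term 2 0 0 4 3 := by
  ext m
  by_cases hm : ∃ a b c d, m = mk4 a b c d
  · obtain ⟨a, b, c, d, rfl⟩ := hm
    rw [show MvPowerSeries.coeff (mk4 a b c d) (sCorr 5) = _ from sCorr_mk4 2 a b c d]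
    simp only [map_add, term_mk4, choose_val]
    by_cases h : b + 2 * c + 3 * d = 2
    · obtain ⟨rfl, rfl, rfl⟩ | ⟨rfl, rfl, rfl⟩ :
        (b = 2 ∧ c = 0 ∧ d = 0) ∨ (b = 0 ∧ c = 1 ∧ d = 0) := by omega
      · rw [show 2 + a + 2 + 0 + 0 = 4 + a by ring]
        generalize (4 + a).factorial = x
        simp [Nat.factorial]
        ring
      · rw [show 2 + a + 0 + 1 + 0 = 3 + a by ring]
        generalize (3 + a).factorial = x
        simp [Nat.factorial]
        ring
    · rw [if_neg h, if_neg (by omega), if_neg (by omega), add_zero]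
  · push Not at hm
    rw [show MvPowerSeries.coeff m (sCorr 5) = _ from sCorr_other 2 (by omega) m hm]
    simp [term_other _ _ _ _ _ _ hm]

lemma s6 : sCorr 6 = term 0 0 1 4 1 + term 1 1 0 5 10 + term 3 0 0 6 15 := by
  ext m
  by_cases hm : ∃ a b c d, m = mk4 a b c d
  · obtain ⟨a, b, c, d, rfl⟩ := hm
    rw [show MvPowerSeries.coeff (mk4 a b c d) (sCorr 6) = _ from sCorr_mk4 3 a b c d]
    simp only [map_add, term_mk4, choose_val]
    by_cases h : b + 2 * c + 3 * d = 3
    · obtain ⟨rfl, rfl, rfl⟩ | ⟨rfl, rfl, rfl⟩ | ⟨rfl, rfl, rfl⟩ :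
        (b = 3 ∧ c = 0 ∧ d = 0) ∨ (b = 1 ∧ c = 1 ∧ d = 0) ∨ (b = 0 ∧ c = 0 ∧ d = 1) := by omega
      · rw [show 3 + a + 3 + 0 + 0 = 6 + a by ring]
        generalize (6 + a).factorial = x
        simp [Nat.factorial]
        ring
      · rw [show 3 + a + 1 + 1 + 0 = 5 + a by ring]
        generalize (5 + a).factorial = x
        simp [Nat.factorial]
        ring
      · rw [show 3 + a + 0 + 0 + 1 = 4 + a by ring]
        generalize (4 + a).factorial = x
        simp [Nat.factorial]
        ring
    · rw [if_neg h, if_neg (by omega), if_neg (by omega), if_neg (by omega)]; simp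
  · push Not at hm
    rw [show MvPowerSeries.coeff m (sCorr 6) = _ from sCorr_other 3 (by omega) m hm]
    simp [term_other _ _ _ _ _ _ hm]

lemma term_pow (b c d N : ℕ) (r : ℚ) (e : ℕ) :
    (1 - (MvPowerSeries.X 1 : MvPowerSeries ℕ ℚ)) ^ (e + (N + 1)) * term b c d N r =
    MvPowerSeries.C r * MvPowerSeries.X 2 ^ b * MvPowerSeries.X 3 ^ c * MvPowerSeries.X 4 ^ d *
      (1 - (MvPowerSeries.X 1 : MvPowerSeries ℕ ℚ)) ^ e := by
  rw [term, mul_left_comm, G_pow']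
  congr 1
  rw [← MvPowerSeries.monomial_zero_eq_C_apply]
  simp only [MvPowerSeries.X_pow_eq, MvPowerSeries.monomial_mul_monomial, mk4]
  simp only [Finsupp.single_zero, zero_add, mul_one]

local notation "t" i => (MvPowerSeries.X i : MvPowerSeries ℕ ℚ)

theorem stmt17 :
    (1 - (t 1)) * sCorr 3 = 1 ∧
    (1 - (t 1)) ^ 3 * sCorr 4 = (t 2) ∧
    (1 - (t 1)) ^ 5 * sCorr 5 = (t 3) * (1 - (t 1)) + 3 * (t 2) ^ 2 ∧
    (1 - (t 1)) ^ 7 * sCorr 6 =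
      (t 4) * (1 - (t 1)) ^ 2 + 10 * (t 2) * (t 3) * (1 - (t 1)) + 15 * (t 2) ^ 3 := by
  refine ⟨?_, ?_, ?_, ?_⟩
  · have h := term_pow 0 0 0 0 1 0
    rw [s3]
    simpa using h
  · have h := term_pow 1 0 0 2 1 0
    rw [s4]
    simpa using h
  · have h := term_pow 0 1 0 3 1 1
    have h' := term_pow 2 0 0 4 3 0
    have h3 : (MvPowerSeries.C (3 : ℚ) : MvPowerSeries ℕ ℚ) = 3 := map_ofNat _ 3
    rw [s5, mul_add]
    simp only [Nat.reduceAdd, h3, map_one, pow_zero, pow_one, one_mul, mul_one] at h h'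
    rw [h, h']
  · have h := term_pow 0 0 1 4 1 2
    have h' := term_pow 1 1 0 5 10 1
    have h'' := term_pow 3 0 0 6 15 0
    have h3 : (MvPowerSeries.C (10 : ℚ) : MvPowerSeries ℕ ℚ) = 10 := map_ofNat _ 10
    have h4 : (MvPowerSeries.C (15 : ℚ) : MvPowerSeries ℕ ℚ) = 15 := map_ofNat _ 15
    rw [s6, mul_add, mul_add]
    simp only [Nat.reduceAdd, h3, h4, map_one, pow_zero, pow_one, one_mul, mul_one] at h h' h''
    rw [h, h', h'']

end
end
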